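/- arXiv:2511.14797 — 3 statements merged into one kernel-verified Lean document; each statement's English description precedes it below -/
import Mathlib

section
/- For every n ≥ 1, the family of 4^n Pauli strings (P f), indexed by functions f : Fin n → {I, X, Y, Z}, is pairwise orthogonal with respect to the Hilbert–Schmidt inner product (trace((P f)ᴴ · (P g)) = 0 whenever f ≠ g) and forms a basis of the complex vector space of 2^n × 2^n complex matrices; in particular the family is linearly independent and its span is all of M_{2^n}(ℂ). -/
open Matrix

/-- The 2 × 2 identity matrix `I`. -/
noncomputable def PauliI : Matrix (Fin 2) (Fin 2) ℂ := 1

/-- The Pauli spin matrix `X = [[0,1],[1,0]]`. -/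
noncomputable def PauliX : Matrix (Fin 2) (Fin 2) ℂ := !![0, 1; 1, 0]

/-- The Pauli spin matrix `Y = [[0,-i],[i,0]]`. -/
noncomputable def PauliY : Matrix (Fin 2) (Fin 2) ℂ := !![0, -Complex.I; Complex.I, 0]

/-- The Pauli spin matrix `Z = [[1,0],[0,-1]]`. -/
noncomputable def PauliZ : Matrix (Fin 2) (Fin 2) ℂ := !![1, 0; 0, -1]

/-- The four single-qubit Pauli matrices `I, X, Y, Z`, indexed by `Fin 4`. -/
noncomputable def pauli : Fin 4 → Matrix (Fin 2) (Fin 2) ℂ := ![PauliI, PauliX, PauliY, PauliZ]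

/-- The Pauli string `P f = ⊗_{k < n} pauli (f k)`, the `n`-fold Kronecker (tensor)
product of single-qubit Pauli matrices, realized as a `2^n × 2^n` complex matrix
indexed by `Fin n → Fin 2`. -/
noncomputable def PauliString (n : ℕ) (f : Fin n → Fin 4) :
    Matrix (Fin n → Fin 2) (Fin n → Fin 2) ℂ :=
  Matrix.of fun i j => ∏ k, pauli (f k) (i k) (j k)

lemma trace_conjTranspose_pauli_mul_of_ne {a b : Fin 4} (h : a ≠ b) :
    ((pauli a)ᴴ * pauli b).trace = 0 := by
  fin_cases a <;> fin_cases b <;>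
    simp_all [pauli, PauliI, PauliX, PauliY, PauliZ, Matrix.trace, Matrix.mul_apply,
      Fin.sum_univ_two]

lemma trace_conjTranspose_pauli_mul_self (a : Fin 4) :
    ((pauli a)ᴴ * pauli a).trace = 2 := by
  fin_cases a <;>
    simp [pauli, PauliI, PauliX, PauliY, PauliZ, Matrix.trace, Matrix.mul_apply,
      Fin.sum_univ_two] <;> norm_num

/-- The Hilbert–Schmidt inner product of Pauli strings factors over the tensor factors. -/
lemma trace_conjTranspose_pauliString_mul (n : ℕ) (f g : Fin n → Fin 4) :
    ((PauliString n f)ᴴ * PauliString n g).trace = ∏ k, ((pauli (f k))ᴴ * pauli (g k)).trace := by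
  simp only [PauliString, Matrix.trace, Matrix.diag_apply, Matrix.mul_apply,
    Matrix.conjTranspose_apply, Matrix.of_apply, star_prod, ← Finset.prod_mul_distrib,
    Finset.prod_univ_sum, Fintype.piFinset_univ]

lemma trace_conjTranspose_pauliString_mul_of_ne {n : ℕ} {f g : Fin n → Fin 4} (h : f ≠ g) :
    ((PauliString n f)ᴴ * PauliString n g).trace = 0 := by
  obtain ⟨k, hk⟩ := Function.ne_iff.mp h
  rw [trace_conjTranspose_pauliString_mul]
  exact Finset.prod_eq_zero (Finset.mem_univ k) (trace_conjTranspose_pauli_mul_of_ne hk)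

lemma trace_conjTranspose_pauliString_mul_self (n : ℕ) (f : Fin n → Fin 4) :
    ((PauliString n f)ᴴ * PauliString n f).trace = 2 ^ n := by
  simp [trace_conjTranspose_pauliString_mul, trace_conjTranspose_pauli_mul_self]

lemma linearIndependent_pauliString (n : ℕ) : LinearIndependent ℂ (PauliString n) := by
  rw [Fintype.linearIndependent_iff]
  intro c hc f
  have h : ((PauliString n f)ᴴ * ∑ g, c g • PauliString n g).trace = c f * 2 ^ n := by
    rw [Finset.mul_sum, Matrix.trace_sum, Finset.sum_eq_single f]
    · simp [trace_conjTranspose_pauliString_mul_self]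
    · intro g _ hg
      simp [trace_conjTranspose_pauliString_mul_of_ne hg.symm]
    · simp
  simpa [hc] using h.symm

/-- For `n ≥ 1`, the `4^n` Pauli strings are pairwise orthogonal in the
Hilbert–Schmidt inner product and form a basis of `M_{2^n}(ℂ)`: they are
linearly independent and span the whole matrix space. -/
theorem pauliString_orthogonal_basis (n : ℕ) (hn : 1 ≤ n) :
    (∀ f g : Fin n → Fin 4, f ≠ g →
        ((PauliString n f)ᴴ * PauliString n g).trace = 0) ∧
    LinearIndependent ℂ (PauliString n) ∧
    Submodule.span ℂ (Set.range (PauliString n)) = ⊤ := by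
  refine ⟨fun f g => trace_conjTranspose_pauliString_mul_of_ne,
    linearIndependent_pauliString n,
    (linearIndependent_pauliString n).span_eq_top_of_card_eq_finrank' ?_⟩
  simp [Module.finrank_matrix, ← mul_pow]
end

section
/- Let n ≥ 1, let U be a 2^n × 2^n complex matrix with Pauli expansion U = Σ_f c_f · P f (the sum over all f : Fin n → {I, X, Y, Z}, with coefficients c_f ∈ ℂ), and let g : Fin n → {I, X, Y, Z}. If U commutes with P g, then c_f = 0 for every f such that P f anticommutes with P g (i.e., P f · P g = −(P g · P f)). -/
open Matrix

/-- The Kronecker (tensor) product of a finite family of square matrices. -/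
def kroneckerPi {ι m R : Type*} [Fintype ι] [CommSemiring R] (A : ι → Matrix m m R) :
    Matrix (ι → m) (ι → m) R :=
  Matrix.of fun i j => ∏ k, A k (i k) (j k)

theorem kroneckerPi_mul {ι m R : Type*} [Fintype ι] [DecidableEq ι] [Fintype m] [CommSemiring R]
    (A B : ι → Matrix m m R) :
    kroneckerPi A * kroneckerPi B = kroneckerPi fun k => A k * B k := by
  ext i j
  simp only [kroneckerPi, Matrix.mul_apply, Matrix.of_apply, ← Finset.prod_mul_distrib]
  exact (Fintype.prod_sum fun k l => A k (i k) l * B k l (j k)).symm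

theorem kroneckerPi_one {ι m R : Type*} [Fintype ι] [DecidableEq m] [CommSemiring R] :
    kroneckerPi (fun _ : ι => (1 : Matrix m m R)) = 1 := by
  ext i j
  simp [kroneckerPi, Matrix.one_apply, Finset.prod_ite_zero, funext_iff]

theorem trace_kroneckerPi {ι m R : Type*} [Fintype ι] [DecidableEq ι] [Fintype m] [CommSemiring R]
    (A : ι → Matrix m m R) :
    (kroneckerPi A).trace = ∏ k, (A k).trace := by
  simp only [kroneckerPi, Matrix.trace, Matrix.diag_apply, Matrix.of_apply]
  exact (Fintype.prod_sum fun k l => A k l l).symm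

theorem pauli_mul_self (a : Fin 4) : pauli a * pauli a = 1 := by
  fin_cases a <;>
    simp [pauli, PauliI, PauliX, PauliY, PauliZ, Matrix.one_fin_two]

theorem trace_pauli_mul (a b : Fin 4) :
    (pauli a * pauli b).trace = if a = b then 2 else 0 := by
  split_ifs with h
  · simp [h, pauli_mul_self]
  · fin_cases a <;> fin_cases b <;>
      simp_all [pauli, PauliI, PauliX, PauliY, PauliZ, Matrix.trace_fin_two]

theorem PauliString_mul_self (n : ℕ) (f : Fin n → Fin 4) :
    PauliString n f * PauliString n f = 1 := by
  change kroneckerPi (fun k => pauli (f k)) * kroneckerPi (fun k => pauli (f k)) = 1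
  simp only [kroneckerPi_mul, pauli_mul_self, kroneckerPi_one]

theorem trace_PauliString_mul (n : ℕ) (f h : Fin n → Fin 4) :
    (PauliString n f * PauliString n h).trace = if f = h then 2 ^ n else 0 := by
  change (kroneckerPi (fun k => pauli (f k)) * kroneckerPi (fun k => pauli (h k))).trace = _
  simp [kroneckerPi_mul, trace_kroneckerPi, trace_pauli_mul, Finset.prod_ite_zero, funext_iff]

theorem trace_PauliString_mul_sum (n : ℕ) (c : (Fin n → Fin 4) → ℂ) (f : Fin n → Fin 4) :
    (PauliString n f * ∑ h, c h • PauliString n h).trace = c f * 2 ^ n := by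
  simp [Finset.mul_sum, Matrix.trace_sum, trace_PauliString_mul]

/-- If `A` anticommutes and `U` commutes with an involution `G`, then `A * U` is traceless. -/
theorem trace_mul_eq_zero_of_anticommute {m : Type*} [Fintype m] [DecidableEq m]
    {A U G : Matrix m m ℂ} (hG : G * G = 1) (hA : A * G = -(G * A)) (hU : U * G = G * U) :
    (A * U).trace = 0 := by
  have h : (A * U).trace = -(A * U).trace := calc
    (A * U).trace = (A * (G * G) * U).trace := by rw [hG, mul_one]
    _ = (A * G * (U * G)).trace := by rw [hU]; simp only [mul_assoc]
    _ = -(G * (A * U * G)).trace := by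
      rw [hA, neg_mul, Matrix.trace_neg]; simp only [mul_assoc]
    _ = -(A * U).trace := by rw [Matrix.trace_mul_comm, mul_assoc, hG, mul_one]
  exact self_eq_neg.mp h

/-- If `U = Σ_f c_f • P f` commutes with the Pauli string `P g`, then the
coefficient `c_f` vanishes for every `f` whose Pauli string anticommutes
with `P g`. -/
theorem pauli_expansion_coeff_eq_zero_of_commute (n : ℕ) (hn : 1 ≤ n)
    (c : (Fin n → Fin 4) → ℂ) (g : Fin n → Fin 4)
    (U : Matrix (Fin n → Fin 2) (Fin n → Fin 2) ℂ)
    (hU : U = ∑ f : Fin n → Fin 4, c f • PauliString n f)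
    (hcomm : U * PauliString n g = PauliString n g * U) :
    ∀ f : Fin n → Fin 4,
      PauliString n f * PauliString n g = -(PauliString n g * PauliString n f) →
      c f = 0 := by
  intro f hf
  have h := trace_mul_eq_zero_of_anticommute (PauliString_mul_self n g) hf hcomm
  rw [hU, trace_PauliString_mul_sum] at h
  simpa using h
end

section
/- Let n ≥ 1 and let S be a finite abelian subgroup of the group of units of M_{2^n}(ℂ) whose elements are all signed Pauli strings (each element of S equals ±P f for some f : Fin n → {I, X, Y, Z}) and with −1 ∉ S. Then the averaging operator Π = |S|⁻¹ · Σ_{s ∈ S} s is an orthogonal projection (Π² = Π and Πᴴ = Π) whose range is the stabilized subspace V_S = {v ∈ ℂ^{2^n} : s·v = v for all s ∈ S}, and its rank satisfies rank(Π) · |S| = 2^n. -/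
open Matrix

theorem isHermitian_pauli (a : Fin 4) : (pauli a).IsHermitian := by
  ext i j
  fin_cases a <;> fin_cases i <;> fin_cases j <;>
    simp [pauli, PauliI, PauliX, PauliY, PauliZ]

theorem trace_pauli_of_ne_zero {a : Fin 4} (ha : a ≠ 0) : (pauli a).trace = 0 := by
  fin_cases a <;> simp_all [pauli, PauliX, PauliY, PauliZ, Matrix.trace]

theorem isHermitian_pauliString (n : ℕ) (f : Fin n → Fin 4) : (PauliString n f).IsHermitian := by
  ext i j
  simp only [PauliString, conjTranspose_apply, of_apply, star_prod]
  exact Finset.prod_congr rfl fun k _ => (isHermitian_pauli (f k)).apply _ _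

theorem trace_pauliString (n : ℕ) (f : Fin n → Fin 4) :
    (PauliString n f).trace = ∏ k, (pauli (f k)).trace := by
  simp only [Matrix.trace, PauliString, diag_apply, of_apply]
  exact (Fintype.prod_sum fun k a => pauli (f k) a a).symm

theorem pauliString_zero (n : ℕ) : PauliString n 0 = 1 := by
  ext i j
  simp only [PauliString, pauli, PauliI, of_apply, Pi.zero_apply, cons_val_zero]
  by_cases h : i = j
  · subst h
    rw [one_apply_eq]
    exact Finset.prod_eq_one fun k _ => one_apply_eq _
  · obtain ⟨k, hk⟩ := Function.ne_iff.mp h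
    rw [one_apply_ne h]
    exact Finset.prod_eq_zero (Finset.mem_univ k) (one_apply_ne hk)

theorem trace_pauliString_of_ne_zero {n : ℕ} {f : Fin n → Fin 4} (hf : f ≠ 0) :
    (PauliString n f).trace = 0 := by
  obtain ⟨k, hk⟩ := Function.ne_iff.mp hf
  rw [trace_pauliString]
  exact Finset.prod_eq_zero (Finset.mem_univ k) (trace_pauli_of_ne_zero hk)

theorem Matrix.trace_eq_rank_of_isIdempotentElem {m K : Type*} [Fintype m] [DecidableEq m]
    [Field K] {A : Matrix m m K} (hA : IsIdempotentElem A) : A.trace = A.rank := by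
  have h : IsIdempotentElem (toLin' A) := by
    rw [IsIdempotentElem, Module.End.mul_eq_comp, ← toLin'_mul, hA.eq]
  rw [← trace_toLin'_eq, (LinearMap.IsIdempotentElem.isProj_range _ h).trace]
  rfl

/-- For a finite abelian subgroup `S` of units of `M_{2^n}(ℂ)` consisting of signed
Pauli strings with `-1 ∉ S`, the averaging operator `Π = |S|⁻¹ • Σ_{s ∈ S} s` is an
orthogonal projection whose range is the stabilized subspace
`V_S = {v | s · v = v for all s ∈ S}`, and `rank Π * |S| = 2^n`. -/
theorem stabilizer_averaging_projection (n : ℕ) (hn : 1 ≤ n)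
    (S : Subgroup (Matrix (Fin n → Fin 2) (Fin n → Fin 2) ℂ)ˣ) [Fintype S]
    (habel : ∀ a ∈ S, ∀ b ∈ S, a * b = b * a)
    (hpauli : ∀ s ∈ S, ∃ f : Fin n → Fin 4,
        (s : Matrix (Fin n → Fin 2) (Fin n → Fin 2) ℂ) = PauliString n f ∨
        (s : Matrix (Fin n → Fin 2) (Fin n → Fin 2) ℂ) = -PauliString n f)
    (hneg : (-1 : (Matrix (Fin n → Fin 2) (Fin n → Fin 2) ℂ)ˣ) ∉ S) :
    let Proj : Matrix (Fin n → Fin 2) (Fin n → Fin 2) ℂ :=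
      (Nat.card S : ℂ)⁻¹ •
        ∑ s : S, ((s : (Matrix (Fin n → Fin 2) (Fin n → Fin 2) ℂ)ˣ) :
          Matrix (Fin n → Fin 2) (Fin n → Fin 2) ℂ)
    Proj * Proj = Proj ∧ Projᴴ = Proj ∧
    (∀ v : (Fin n → Fin 2) → ℂ,
        (∃ w, Proj.mulVec w = v) ↔
        ∀ s ∈ S, (s : Matrix (Fin n → Fin 2) (Fin n → Fin 2) ℂ).mulVec v = v) ∧
    Proj.rank * Nat.card S = 2 ^ n := by
  intro Proj
  have hcard : (Nat.card S : ℂ) ≠ 0 := Nat.cast_ne_zero.mpr Nat.card_pos.ne'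
  have hmul (s) (hs : s ∈ S) :
      (s : Matrix (Fin n → Fin 2) (Fin n → Fin 2) ℂ) * Proj = Proj := by
    simp only [Proj, mul_smul_comm, Finset.mul_sum]
    congr 1
    exact Fintype.sum_equiv (Equiv.mulLeft (⟨s, hs⟩ : S)) _ _ fun t => rfl
  have hidem : Proj * Proj = Proj := by
    conv_lhs => enter [1]; simp only [Proj]
    rw [smul_mul_assoc, Finset.sum_mul, Finset.sum_congr rfl fun s _ => hmul s.1 s.2]
    rw [Finset.sum_const, Finset.card_univ, ← Nat.card_eq_fintype_card,
      ← Nat.cast_smul_eq_nsmul ℂ, inv_smul_smul₀ hcard]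
  have hherm : Projᴴ = Proj := by
    simp only [Proj, conjTranspose_smul, conjTranspose_sum, star_inv₀, star_natCast]
    congr 1
    refine Finset.sum_congr rfl fun s _ => ?_
    obtain ⟨f, hf | hf⟩ := hpauli s s.2
    · rw [hf, (isHermitian_pauliString n f).eq]
    · rw [hf, conjTranspose_neg, (isHermitian_pauliString n f).eq]
  have htrace (s : S) (hs : s ≠ 1) :
      ((s : (Matrix (Fin n → Fin 2) (Fin n → Fin 2) ℂ)ˣ) :
        Matrix (Fin n → Fin 2) (Fin n → Fin 2) ℂ).trace = 0 := by
    obtain ⟨f, hf⟩ := hpauli s s.2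
    rcases eq_or_ne f 0 with rfl | hf0
    · rw [pauliString_zero] at hf
      rcases hf with hf | hf
      · exact absurd (Subtype.ext (Units.ext hf)) hs
      · have h : (s : (Matrix (Fin n → Fin 2) (Fin n → Fin 2) ℂ)ˣ) = -1 := Units.ext hf
        exact absurd (h ▸ s.2) hneg
    · rcases hf with hf | hf <;> simp [hf, trace_pauliString_of_ne_zero hf0]
  refine ⟨hidem, hherm, fun v => ⟨?_, fun hv => ⟨v, ?_⟩⟩, ?_⟩
  · rintro ⟨w, rfl⟩ s hs
    rw [mulVec_mulVec, hmul s hs]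
  · simp only [Proj, smul_mulVec, sum_mulVec]
    rw [Finset.sum_congr rfl fun s _ => hv s.1 s.2]
    rw [Finset.sum_const, Finset.card_univ, ← Nat.card_eq_fintype_card,
      ← Nat.cast_smul_eq_nsmul ℂ, inv_smul_smul₀ hcard]
  · have h : Proj.trace = (Nat.card S : ℂ)⁻¹ * 2 ^ n := by
      simp only [Proj, trace_smul, trace_sum, smul_eq_mul]
      rw [Finset.sum_eq_single 1 (fun s _ hs => htrace s hs) (by simp)]
      simp
    rw [trace_eq_rank_of_isIdempotentElem hidem, eq_inv_mul_iff_mul_eq₀ hcard, mul_comm] at h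
    exact_mod_cast h
end
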